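/- Let I be an infinite set and let p, q be real numbers with 1 < q < ∞ and p > max{2, q}. If Y is a finite-dimensional subspace of some L_q(μ) space, then the norm of the projective tensor product ℓ_p(I) ⊗̂_π Y* is strongly subdifferentiable (SSD) at every point of its unit sphere. -/

import Mathlib

open scoped ENNReal

/-- The set of all sums `Σ ‖u i‖ * ‖v i‖` over finite representations
`z = Σ u i ⊗ v i` of `z` as a sum of elementary tensors. -/
def projRepSums {X Y Z : Type*} [NormedAddCommGroup X] [NormedSpace ℝ X]
    [NormedAddCommGroup Y] [NormedSpace ℝ Y] [NormedAddCommGroup Z] [NormedSpace ℝ Z]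
    (tp : X →ₗ[ℝ] Y →ₗ[ℝ] Z) (z : Z) : Set ℝ :=
  { r | ∃ (k : ℕ) (u : Fin k → X) (v : Fin k → Y),
      z = ∑ i, tp (u i) (v i) ∧ r = ∑ i, ‖u i‖ * ‖v i‖ }

/-- The Banach space `Z`, together with the bilinear map `tp`, is (an isometric copy of) the
projective tensor product `X ⊗̂_π Y`: the span of the elementary tensors is dense in `Z`, and the
norm of any finite sum of elementary tensors is its projective norm, i.e. the infimum of
`Σ ‖u i‖ * ‖v i‖` over all finite representations. -/
structure IsProjectiveTensorProduct {X Y Z : Type*} [NormedAddCommGroup X] [NormedSpace ℝ X]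
    [NormedAddCommGroup Y] [NormedSpace ℝ Y] [NormedAddCommGroup Z] [NormedSpace ℝ Z]
    [CompleteSpace Z] (tp : X →ₗ[ℝ] Y →ₗ[ℝ] Z) : Prop where
  dense_span : Dense ((Submodule.span ℝ
    (Set.range fun xy : X × Y => tp xy.1 xy.2) : Submodule ℝ Z) : Set Z)
  norm_eq : ∀ (k : ℕ) (u : Fin k → X) (v : Fin k → Y),
    ‖∑ i, tp (u i) (v i)‖ = sInf (projRepSums tp (∑ i, tp (u i) (v i)))

/-- `z` is an SSD point of the unit sphere of `Z`: `‖z‖ = 1` and the one-sided limit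
`lim_{t → 0⁺} (‖z + t • h‖ - 1) / t` exists uniformly in `h` on the unit sphere of `Z`. -/
def IsSSDPoint {Z : Type*} [NormedAddCommGroup Z] [NormedSpace ℝ Z] (z : Z) : Prop :=
  ‖z‖ = 1 ∧ ∃ G : Z → ℝ, ∀ ε > (0 : ℝ), ∃ δ > (0 : ℝ), ∀ t : ℝ, 0 < t → t < δ →
    ∀ h : Z, ‖h‖ = 1 → |(‖z + t • h‖ - 1) / t - G h| < ε

open Filter Topology

section SequenceSpace

variable {I : Type*} {P : ℝ≥0∞}

theorem lp.norm_smul_add_smul_le_one_of_disjoint [Fact (1 ≤ P)] (hP : P ≠ ⊤) (s : Finset I)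
    {x y : lp (fun _ : I => ℝ) P}
    (hx : ∀ i, i ∉ s → x i = 0) (hy : ∀ i ∈ s, y i = 0) (hx1 : ‖x‖ ≤ 1) (hy1 : ‖y‖ ≤ 1)
    {b : ℝ} (hb0 : 0 ≤ b) (hb1 : b ≤ 1) :
    ‖(1 - b ^ P.toReal) • x + b • y‖ ≤ 1 := by
  have h1P : 1 ≤ P.toReal := by
    have := ENNReal.toReal_mono hP (Fact.out : 1 ≤ P)
    simpa using this
  have hP0 : 0 < P.toReal := by linarith
  have hbp1 : b ^ P.toReal ≤ 1 := Real.rpow_le_one hb0 hb1 hP0.le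
  have hbp0 : 0 ≤ b ^ P.toReal := Real.rpow_nonneg hb0 _
  have key : ‖(1 - b ^ P.toReal) • x + b • y‖ ^ P.toReal =
      (1 - b ^ P.toReal) ^ P.toReal * ‖x‖ ^ P.toReal + b ^ P.toReal * ‖y‖ ^ P.toReal := by
    refine (lp.hasSum_norm hP0 _).unique ?_
    have hsum := ((lp.hasSum_norm hP0 x).mul_left ((1 - b ^ P.toReal) ^ P.toReal)).add
      ((lp.hasSum_norm hP0 y).mul_left (b ^ P.toReal))
    refine (congrArg (HasSum · _) (funext fun i => ?_)).mpr hsum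
    rw [lp.coeFn_add, lp.coeFn_smul, lp.coeFn_smul, Pi.add_apply, Pi.smul_apply, Pi.smul_apply]
    by_cases hi : i ∈ s
    · rw [hy i hi]
      simp [Real.zero_rpow hP0.ne', Real.mul_rpow (sub_nonneg.2 hbp1) (abs_nonneg _),
        abs_of_nonneg (sub_nonneg.2 hbp1)]
    · rw [hx i hi]
      simp [Real.zero_rpow hP0.ne', Real.mul_rpow hb0 (abs_nonneg _),
        abs_of_nonneg hb0]
  have hxp : ‖x‖ ^ P.toReal ≤ 1 := Real.rpow_le_one (norm_nonneg _) hx1 hP0.le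
  have hyp : ‖y‖ ^ P.toReal ≤ 1 := Real.rpow_le_one (norm_nonneg _) hy1 hP0.le
  have h1 : (1 - b ^ P.toReal) ^ P.toReal ≤ 1 - b ^ P.toReal :=
    Real.rpow_le_self_of_le_one (sub_nonneg.2 hbp1) (by linarith) h1P
  have h0 : 0 ≤ (1 - b ^ P.toReal) ^ P.toReal := Real.rpow_nonneg (sub_nonneg.2 hbp1) _
  have hle : ‖(1 - b ^ P.toReal) • x + b • y‖ ^ P.toReal ≤ 1 := by
    rw [key]
    nlinarith [mul_le_mul_of_nonneg_left hxp h0, mul_le_mul_of_nonneg_left hyp hbp0]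
  by_contra! hlt
  exact hle.not_gt (Real.one_lt_rpow hlt hP0)


theorem lp.norm_sub_sum_single_le [Fact (1 ≤ P)] [DecidableEq I] (hP : P ≠ ⊤) (s : Finset I) (y : lp (fun _ : I => ℝ) P) :
    ‖y - ∑ i ∈ s, lp.single P i (y i)‖ ≤ ‖y‖ := by
  have hP0 : 0 < P.toReal := ENNReal.toReal_pos (zero_lt_one.trans_le Fact.out).ne' hP
  rw [← Real.rpow_le_rpow_iff (norm_nonneg _) (norm_nonneg _) hP0,
    lp.norm_compl_sum_single hP0 y s]
  have : 0 ≤ ∑ i ∈ s, ‖y i‖ ^ P.toReal :=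
    Finset.sum_nonneg fun i _ => Real.rpow_nonneg (norm_nonneg _) _
  linarith

theorem lp.sum_single_apply_of_mem [DecidableEq I] {s : Finset I} (y : lp (fun _ : I => ℝ) P) {i : I}
    (hi : i ∈ s) : (∑ j ∈ s, lp.single P j (y j) : lp (fun _ : I => ℝ) P) i = y i := by
  rw [lp.coeFn_sum, Finset.sum_apply]
  simp only [lp.coeFn_single, Finset.sum_pi_single, hi, if_true]

theorem lp.sum_single_apply_of_notMem [DecidableEq I] {s : Finset I} (y : lp (fun _ : I => ℝ) P) {i : I}
    (hi : i ∉ s) : (∑ j ∈ s, lp.single P j (y j) : lp (fun _ : I => ℝ) P) i = 0 := by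
  rw [lp.coeFn_sum, Finset.sum_apply]
  simp only [lp.coeFn_single, Finset.sum_pi_single, hi, if_false]

theorem ContinuousLinearMap.exists_norm_lt_one_lt_apply {E : Type*} [NormedAddCommGroup E]
    [NormedSpace ℝ E] (φ : E →L[ℝ] ℝ) {r : ℝ} (hr : r < ‖φ‖) : ∃ x, ‖x‖ < 1 ∧ r < φ x := by
  obtain ⟨x, hx, hrx⟩ := φ.exists_lt_apply_of_lt_opNorm hr
  rcases abs_cases (φ x) with ⟨h, -⟩ | ⟨h, -⟩
  · exact ⟨x, hx, by rwa [Real.norm_eq_abs, h] at hrx⟩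
  · exact ⟨-x, by rwa [norm_neg], by rwa [Real.norm_eq_abs, h, ← map_neg] at hrx⟩

/-- A functional on `ℓ_P`, `1 < P < ∞`, almost attains its norm at a finitely supported vector and
is small on the vectors supported off the same finite set. -/
theorem lp.exists_finset_norming [Fact (1 ≤ P)] (hP : P ≠ ⊤) (hP1 : 1 < P.toReal)
    (φ : lp (fun _ : I => ℝ) P →L[ℝ] ℝ) {ε : ℝ} (hε : 0 < ε) :
    ∃ (s : Finset I) (x : lp (fun _ : I => ℝ) P), (∀ i, i ∉ s → x i = 0) ∧ ‖x‖ ≤ 1 ∧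
      ‖φ‖ - ε ≤ φ x ∧
      ∀ y : lp (fun _ : I => ℝ) P, ‖y‖ ≤ 1 → (∀ i ∈ s, y i = 0) → φ y ≤ ε := by
  classical
  have hlim : Tendsto (fun b : ℝ => b ^ (P.toReal - 1) * ‖φ‖) (𝓝[>] 0) (𝓝 0) := by
    have h : ContinuousAt (fun b : ℝ => b ^ (P.toReal - 1) * ‖φ‖) 0 :=
      (Real.continuousAt_rpow_const _ _ (Or.inr (by linarith))).mul continuousAt_const
    have h2 := h.tendsto
    rw [Real.zero_rpow (by linarith), zero_mul] at h2
    exact h2.mono_left nhdsWithin_le_nhds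
  obtain ⟨b, hbε, hb0, hb1⟩ := ((hlim.eventually_lt_const (half_pos hε)).and
    (Ioc_mem_nhdsGT zero_lt_one)).exists
  have hbr : b ^ P.toReal = b * b ^ (P.toReal - 1) := by
    rw [Real.rpow_sub_one hb0.ne']; field_simp
  have hbp1 : b ^ P.toReal ≤ 1 := Real.rpow_le_one hb0.le hb1 (by linarith)
  have hbp0 : 0 ≤ b ^ P.toReal := Real.rpow_nonneg hb0.le _
  obtain ⟨x₀, hx₀, hφ⟩ := φ.exists_norm_lt_one_lt_apply
    (show ‖φ‖ - ε * b / 2 < ‖φ‖ by linarith [mul_pos hε hb0])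
  have hs := lp.hasSum_single hP x₀
  obtain ⟨s, hs1, hs2⟩ := ((hs.norm.eventually_lt_const hx₀).and
    (((φ.continuous.tendsto x₀).comp hs).eventually_const_lt hφ)).exists
  refine ⟨s, ∑ i ∈ s, lp.single P i (x₀ i), fun i hi => lp.sum_single_apply_of_notMem x₀ hi,
    hs1.le, ?_, fun y hy hys => ?_⟩
  · simp only [Function.comp] at hs2
    nlinarith
  · have h1 := lp.norm_smul_add_smul_le_one_of_disjoint hP s
      (fun i hi => lp.sum_single_apply_of_notMem x₀ hi) hys hs1.le hy hb0.le hb1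
    have h2 := (le_abs_self _).trans (φ.le_opNorm_of_le h1)
    rw [map_add, map_smul, map_smul, smul_eq_mul, smul_eq_mul] at h2
    simp only [Function.comp] at hs2
    have h3 : (1 - b ^ P.toReal) * (‖φ‖ - ε * b / 2) ≤
        (1 - b ^ P.toReal) * φ (∑ i ∈ s, lp.single P i (x₀ i)) :=
      mul_le_mul_of_nonneg_left hs2.le (sub_nonneg.2 hbp1)
    have h4 : b * φ y ≤ b * ε := by
      rw [hbr] at h2 h3 hbp0
      nlinarith [mul_pos hε hb0]
    exact le_of_mul_le_mul_left h4 hb0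

/-- Asymptotic superadditivity of the dual norm of `ℓ_P` along pointwise convergent families. -/
theorem lp.norm_add_limit_norm_sub_le [Fact (1 ≤ P)] (hP : P ≠ ⊤) (hP1 : 1 < P.toReal) {ι : Type*}
    {l : Filter ι} [l.NeBot] {φ : ι → lp (fun _ : I => ℝ) P →L[ℝ] ℝ}
    {ψ : lp (fun _ : I => ℝ) P →L[ℝ] ℝ} (hφ : ∀ x, Tendsto (fun n => φ n x) l (𝓝 (ψ x)))
    {M L : ℝ} (hM : ∀ n, ‖φ n‖ ≤ M) (hL : Tendsto (fun n => ‖φ n - ψ‖) l (𝓝 L))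
    {b : ℝ} (hb0 : 0 ≤ b) (hb1 : b ≤ 1) :
    (1 - b ^ P.toReal) * ‖ψ‖ + b * L ≤ M := by
  classical
  have hbp1 : b ^ P.toReal ≤ 1 := Real.rpow_le_one hb0 hb1 (by linarith)
  have hbp0 : 0 ≤ b ^ P.toReal := Real.rpow_nonneg hb0 _
  have hP0 : P ≠ 0 := (zero_lt_one.trans_le Fact.out).ne'
  suffices H : ∀ ε > 0, (1 - b ^ P.toReal) * ‖ψ‖ + b * L ≤ M + 3 * ε by
    refine le_of_forall_pos_le_add fun ε hε => (H (ε / 3) (by positivity)).trans (by linarith)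
  intro ε hε
  obtain ⟨s, x, hxs, hx1, hψx, htail⟩ := lp.exists_finset_norming hP hP1 ψ hε
  have hn : ∀ n, (1 - b ^ P.toReal) * φ n x +
      b * (‖φ n - ψ‖ - ε - ∑ i ∈ s, |φ n (lp.single P i 1) - ψ (lp.single P i 1)| - ε) ≤ M := by
    intro n
    obtain ⟨y, hy1, hy⟩ := (φ n - ψ).exists_norm_lt_one_lt_apply
      (show ‖φ n - ψ‖ - ε < ‖φ n - ψ‖ by linarith)
    set h := ∑ i ∈ s, lp.single P i (y i) with hh
    have hz0 : ∀ i ∈ s, (y - h) i = 0 := fun i hi => by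
      rw [lp.coeFn_sub, Pi.sub_apply, hh, lp.sum_single_apply_of_mem y hi, sub_self]
    have hz1 : ‖y - h‖ ≤ 1 := (lp.norm_sub_sum_single_le hP s y).trans hy1.le
    have h1 := lp.norm_smul_add_smul_le_one_of_disjoint hP s hxs hz0 hx1 hz1 hb0 hb1
    have h2 := (le_abs_self _).trans ((φ n).le_of_opNorm_le_of_le (hM n) h1)
    rw [map_add, map_smul, map_smul, smul_eq_mul, smul_eq_mul, mul_one] at h2
    have h3 : -ε ≤ ψ (y - h) := by
      have := htail (-(y - h)) (by rwa [norm_neg]) fun i hi => by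
        rw [lp.coeFn_neg, Pi.neg_apply, hz0 i hi, neg_zero]
      rw [map_neg] at this
      linarith
    have h4 : (φ n - ψ) h ≤ ∑ i ∈ s, |φ n (lp.single P i 1) - ψ (lp.single P i 1)| := by
      rw [hh, map_sum]
      refine Finset.sum_le_sum fun i _ => ?_
      have hsm : (lp.single P i (y i) : lp (fun _ : I => ℝ) P) = y i • lp.single P i 1 := by
        rw [← lp.single_smul, smul_eq_mul, mul_one]
      rw [hsm, map_smul, smul_eq_mul]
      refine (le_abs_self _).trans ?_
      rw [abs_mul, _root_.sub_apply]
      exact mul_le_of_le_one_left (abs_nonneg _)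
        ((lp.norm_apply_le_norm hP0 y i).trans hy1.le)
    have h5 : φ n (y - h) = (φ n - ψ) y - (φ n - ψ) h + ψ (y - h) := by
      simp only [_root_.sub_apply, map_sub]; ring
    have h6 : ‖φ n - ψ‖ - ε - ∑ i ∈ s, |φ n (lp.single P i 1) - ψ (lp.single P i 1)| - ε ≤
        φ n (y - h) := by linarith
    nlinarith [mul_le_mul_of_nonneg_left h6 hb0]
  have hlim : Tendsto (fun n => (1 - b ^ P.toReal) * φ n x +
      b * (‖φ n - ψ‖ - ε - ∑ i ∈ s, |φ n (lp.single P i 1) - ψ (lp.single P i 1)| - ε)) l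
      (𝓝 ((1 - b ^ P.toReal) * ψ x + b * (L - ε - 0 - ε))) := by
    have hsum : Tendsto (fun n => ∑ i ∈ s, |φ n (lp.single P i 1) - ψ (lp.single P i 1)|) l
        (𝓝 0) := by
      rw [← Finset.sum_const_zero (s := s)]
      refine tendsto_finsetSum _ fun i _ => ?_
      have := ((hφ (lp.single P i 1)).sub_const (ψ (lp.single P i 1))).abs
      rwa [sub_self, abs_zero] at this
    exact ((hφ x).const_mul _).add
      ((((hL.sub_const ε).sub hsum).sub_const ε).const_mul b)
  have := le_of_tendsto' hlim hn
  nlinarith [mul_le_mul_of_nonneg_left hψx (sub_nonneg.2 hbp1)]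

end SequenceSpace

section IntegrableFunctions

open MeasureTheory

theorem Lp.norm_rpow_eq_integral {Ω : Type*} [MeasurableSpace Ω] {μ : Measure Ω} {q : ℝ}
    (hq : 0 < q) (f : Lp ℝ (ENNReal.ofReal q) μ) : ‖f‖ ^ q = ∫ ω, |f ω| ^ q ∂μ := by
  have h0 : ENNReal.ofReal q ≠ 0 := by simpa using hq
  rw [Lp.norm_def, toReal_eLpNorm (Lp.aestronglyMeasurable f),
    lpNorm_eq_integral_norm_rpow_toReal h0 ENNReal.ofReal_ne_top (Lp.aestronglyMeasurable f),
    ENNReal.toReal_ofReal hq.le, ← Real.rpow_mul (integral_nonneg fun ω => by positivity),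
    inv_mul_cancel₀ hq.ne', Real.rpow_one]
  rfl

theorem Lp.integrable_abs_rpow {Ω : Type*} [MeasurableSpace Ω] {μ : Measure Ω} {q : ℝ}
    (hq : 0 < q) (f : Lp ℝ (ENNReal.ofReal q) μ) : Integrable (fun ω => |f ω| ^ q) μ := by
  have h := (Lp.memLp f).integrable_norm_rpow (by simpa using hq) ENNReal.ofReal_ne_top
  rwa [ENNReal.toReal_ofReal hq.le] at h

theorem Lp.norm_sub_rpow_le_of_forall {Ω : Type*} [MeasurableSpace Ω] {μ : Measure Ω} {q : ℝ}
    (hq : 0 < q) {α β : ℝ}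
    (h : ∀ a b : ℝ, |a - b| ^ q ≤ α * (|a| ^ q + |b| ^ q) - β * |a + b| ^ q)
    (f g : Lp ℝ (ENNReal.ofReal q) μ) :
    ‖f - g‖ ^ q ≤ α * (‖f‖ ^ q + ‖g‖ ^ q) - β * ‖f + g‖ ^ q := by
  have hf := Lp.integrable_abs_rpow hq f
  have hg := Lp.integrable_abs_rpow hq g
  have hfg := Lp.integrable_abs_rpow hq (f + g)
  rw [Lp.norm_rpow_eq_integral hq, Lp.norm_rpow_eq_integral hq f, Lp.norm_rpow_eq_integral hq g,
    Lp.norm_rpow_eq_integral hq (f + g), ← integral_add hf hg, ← integral_const_mul,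
    ← integral_const_mul]
  refine le_of_le_of_eq ?_ (integral_sub ((hf.add hg).const_mul α) (hfg.const_mul β))
  refine integral_mono_ae (Lp.integrable_abs_rpow hq _)
    (((hf.add hg).const_mul α).sub (hfg.const_mul β)) ?_
  filter_upwards [Lp.coeFn_add f g, Lp.coeFn_sub f g] with ω h1 h2
  simp only [h1, h2, Pi.add_apply, Pi.sub_apply]
  exact h _ _

theorem abs_sub_rpow_le_of_two_le {q : ℝ} (hq : 2 ≤ q) (a b : ℝ) :
    |a - b| ^ q ≤ 2 ^ (q - 1) * (|a| ^ q + |b| ^ q) - 1 * |a + b| ^ q := by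
  have hsq : ∀ x : ℝ, |x| ^ q = (x ^ 2) ^ (q / 2) := fun x => by
    rw [← sq_abs, ← Real.rpow_natCast, ← Real.rpow_mul (abs_nonneg x)]
    congr 1; push_cast; ring
  have hq1 : 1 ≤ q / 2 := by linarith
  have h1 : ((a + b) ^ 2) ^ (q / 2) + ((a - b) ^ 2) ^ (q / 2) ≤
      ((a + b) ^ 2 + (a - b) ^ 2) ^ (q / 2) :=
    Real.add_rpow_le_rpow_add (sq_nonneg _) (sq_nonneg _) hq1
  have h2 := (convexOn_rpow hq1).2 (Set.mem_Ici.2 (sq_nonneg a)) (Set.mem_Ici.2 (sq_nonneg b))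
    (show (0 : ℝ) ≤ 1 / 2 by norm_num) (show (0 : ℝ) ≤ 1 / 2 by norm_num) (by norm_num)
  simp only [smul_eq_mul] at h2
  have h3 : (a + b) ^ 2 + (a - b) ^ 2 = 4 * (1 / 2 * a ^ 2 + 1 / 2 * b ^ 2) := by ring
  have h4 : (4 : ℝ) ^ (q / 2) = 2 ^ (q - 1) * 2 := by
    rw [show (4 : ℝ) = 2 ^ (2 : ℝ) by norm_num, ← Real.rpow_mul (by norm_num),
      Real.rpow_sub_one (by norm_num)]
    rw [show 2 * (q / 2) = q by ring]; ring
  rw [h3, Real.mul_rpow (by norm_num) (by positivity), h4] at h1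
  simp only [hsq]
  have h5 : (0 : ℝ) < 2 ^ (q - 1) := by positivity
  nlinarith

theorem uniform_convexity_defect {q : ℝ} (hq1 : 1 < q) (hq2 : q ≤ 2) {a b R : ℝ} (hR : 0 < R)
    (ha : |a| ≤ R) (hb : |b| ≤ R) :
    q * (q - 1) / 8 * R ^ (q - 2) * (a - b) ^ 2 ≤
      (|a| ^ q + |b| ^ q) / 2 - |(a + b) / 2| ^ q := by
  set C : ℝ := q * (q - 1) / 2 * R ^ (q - 2) with hC
  have hd1 : ∀ u : ℝ, HasDerivAt (fun u : ℝ => u ^ q - C * u ^ 2)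
      (q * u ^ (q - 1) - C * (2 * u)) u := fun u => by
    have h := (Real.hasDerivAt_rpow_const (x := u) (p := q) (Or.inr hq1.le)).sub
      (((hasDerivAt_id u).pow 2).const_mul C)
    exact h.congr_deriv (by simp)
  have hd2 : ∀ u : ℝ, 0 < u → HasDerivAt (fun u : ℝ => q * u ^ (q - 1) - C * (2 * u))
      (q * ((q - 1) * u ^ (q - 1 - 1)) - C * 2) u := fun u hu => by
    have h := ((Real.hasDerivAt_rpow_const (x := u) (p := q - 1) (Or.inl hu.ne')).const_mul q).sub
      (((hasDerivAt_id u).const_mul 2).const_mul C)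
    exact h.congr_deriv (by simp)
  have hpow : ∀ u : ℝ, 0 < u → u < R → R ^ (q - 2) ≤ u ^ (q - 2) := fun u hu huR =>
    Real.rpow_le_rpow_of_nonpos hu huR.le (by linarith)
  have hcont : ContinuousOn (fun u : ℝ => u ^ q - C * u ^ 2) (Set.Icc 0 R) :=
    fun u _ => (hd1 u).continuousAt.continuousWithinAt
  have hconv : ConvexOn ℝ (Set.Icc 0 R) (fun u : ℝ => u ^ q - C * u ^ 2) := by
    refine convexOn_of_hasDerivWithinAt2_nonneg (convex_Icc 0 R) hcont
      (fun u _ => (hd1 u).hasDerivWithinAt) (fun u hu => (hd2 u ?_).hasDerivWithinAt) ?_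
    · rw [interior_Icc] at hu; exact hu.1
    · intro u hu
      rw [interior_Icc] at hu
      have := hpow u hu.1 hu.2
      rw [show q - 1 - 1 = q - 2 by ring, hC]
      nlinarith [mul_le_mul_of_nonneg_left this
        (mul_nonneg (by linarith : (0 : ℝ) ≤ q) (by linarith : (0 : ℝ) ≤ q - 1))]
  have hmono : MonotoneOn (fun u : ℝ => u ^ q - C * u ^ 2) (Set.Icc 0 R) := by
    refine monotoneOn_of_deriv_nonneg (convex_Icc 0 R) hcont
      (fun u _ => (hd1 u).differentiableAt.differentiableWithinAt) fun u hu => ?_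
    rw [interior_Icc] at hu
    have h := hpow u hu.1 hu.2
    have hu1 : u ^ (q - 1) = u ^ (q - 2) * u := by
      rw [← Real.rpow_add_one hu.1.ne']; congr 1; ring
    rw [(hd1 u).deriv, hu1, hC]
    have hR2 : 0 ≤ R ^ (q - 2) := by positivity
    have h1 : (q - 1) * R ^ (q - 2) ≤ u ^ (q - 2) := by nlinarith
    have := mul_le_mul_of_nonneg_left h1 (mul_nonneg (by linarith : (0 : ℝ) ≤ q) hu.1.le)
    nlinarith
  have hmid : |(a + b) / 2| ≤ (1 / 2) * |a| + (1 / 2) * |b| := by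
    rw [abs_div, abs_two]
    linarith [abs_add_le a b]
  have h1 := hmono ⟨abs_nonneg ((a + b) / 2), by linarith⟩ ⟨by positivity, by linarith⟩ hmid
  have h2 := hconv.2 (⟨abs_nonneg a, ha⟩ : |a| ∈ Set.Icc 0 R) (⟨abs_nonneg b, hb⟩ : |b| ∈ Set.Icc 0 R)
    (show (0 : ℝ) ≤ 1 / 2 by norm_num) (show (0 : ℝ) ≤ 1 / 2 by norm_num) (by norm_num)
  simp only [smul_eq_mul, sq_abs] at h1 h2
  have h3 : q * (q - 1) / 8 * R ^ (q - 2) * (a - b) ^ 2 =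
      C * ((a ^ 2 + b ^ 2) / 2 - ((a + b) / 2) ^ 2) := by rw [hC]; ring
  rw [h3]
  linarith

theorem abs_sub_rpow_le_of_le_two {q : ℝ} (hq1 : 1 < q) (hq2 : q ≤ 2) {θ : ℝ} (hθ : 0 < θ)
    (a b : ℝ) :
    |a - b| ^ q ≤ (θ ^ q + 8 / (q * (q - 1)) * θ ^ (q - 2) / 2) * (|a| ^ q + |b| ^ q) -
      8 / (q * (q - 1)) * θ ^ (q - 2) / 2 ^ q * |a + b| ^ q := by
  have hq0 : q ≠ 0 := by positivity
  obtain ⟨R, hRdef⟩ : ∃ R, R = max |a| |b| := ⟨_, rfl⟩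
  have hqq : 0 < q * (q - 1) := mul_pos (by linarith) (by linarith)
  have haR : |a| ≤ R := hRdef ▸ le_max_left _ _
  have hbR : |b| ≤ R := hRdef ▸ le_max_right _ _
  rcases ((abs_nonneg a).trans haR).eq_or_lt with hR | hR
  · have ha : a = 0 := abs_nonpos_iff.1 (hR ▸ haR)
    have hb : b = 0 := abs_nonpos_iff.1 (hR ▸ hbR)
    simp [ha, hb, Real.zero_rpow hq0]
  have hdef := uniform_convexity_defect hq1 hq2 hR haR hbR
  have habs : |(a + b) / 2| ^ q = |a + b| ^ q / 2 ^ q := by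
    rw [abs_div, abs_two, Real.div_rpow (abs_nonneg _) (by norm_num)]
  rw [habs] at hdef
  have hRpow : R ^ q ≤ |a| ^ q + |b| ^ q := by
    rcases max_choice |a| |b| with h | h <;> rw [hRdef, h]
    · exact le_add_of_nonneg_right (by positivity)
    · exact le_add_of_nonneg_left (by positivity)
  have hR2 : 0 < R ^ (q - 2) := by positivity
  have hθ2 : 0 < θ ^ (q - 2) := by positivity
  have hθq : 0 < θ ^ q := by positivity
  have hmain : θ ^ (q - 2) * R ^ (q - 2) * (a - b) ^ 2 ≤ 8 / (q * (q - 1)) * θ ^ (q - 2) *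
      ((|a| ^ q + |b| ^ q) / 2 - |a + b| ^ q / 2 ^ q) := by
    calc θ ^ (q - 2) * R ^ (q - 2) * (a - b) ^ 2
        = 8 / (q * (q - 1)) * θ ^ (q - 2) *
          (q * (q - 1) / 8 * R ^ (q - 2) * (a - b) ^ 2) := by
          have hq1' : q - 1 ≠ 0 := (sub_pos.2 hq1).ne'
          field_simp
      _ ≤ _ := mul_le_mul_of_nonneg_left hdef (by positivity)
  have hgoal : |a - b| ^ q ≤ θ ^ q * (|a| ^ q + |b| ^ q) +
      θ ^ (q - 2) * R ^ (q - 2) * (a - b) ^ 2 := by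
    rcases le_total |a - b| (θ * R) with h | h
    · have h1 := Real.rpow_le_rpow (abs_nonneg _) h (by linarith : 0 ≤ q)
      rw [Real.mul_rpow hθ.le hR.le] at h1
      have h2 := mul_le_mul_of_nonneg_left hRpow hθq.le
      have h3 : 0 ≤ θ ^ (q - 2) * R ^ (q - 2) * (a - b) ^ 2 := by positivity
      linarith
    · have hab : 0 < |a - b| := (mul_pos hθ hR).trans_le h
      have h1 := Real.rpow_le_rpow_of_nonpos (mul_pos hθ hR) h (by linarith : q - 2 ≤ 0)
      rw [Real.mul_rpow hθ.le hR.le] at h1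
      have h2 : |a - b| ^ q = |a - b| ^ (q - 2) * (a - b) ^ 2 := by
        rw [← sq_abs (a - b), ← Real.rpow_natCast, ← Real.rpow_add hab]
        congr 1; push_cast; ring
      have h3 := mul_le_mul_of_nonneg_right h1 (sq_nonneg (a - b))
      have h4 : 0 ≤ θ ^ q * (|a| ^ q + |b| ^ q) := by positivity
      linarith
  refine hgoal.trans ((add_le_add_right hmain _).trans (le_of_eq ?_))
  ring

/-- `L_q` is uniformly convex of power type `max 2 q`. -/
theorem Lp.exists_norm_add_le_two_sub {Ω : Type*} [MeasurableSpace Ω] (μ : Measure Ω) {q : ℝ}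
    (hq1 : 1 < q) [Fact (1 ≤ ENNReal.ofReal q)] :
    ∃ c > 0, ∀ f g : Lp ℝ (ENNReal.ofReal q) μ, ‖f‖ ≤ 1 → ‖g‖ ≤ 1 →
      ‖f + g‖ ≤ 2 - c * ‖f - g‖ ^ max 2 q := by
  have hq0 : 0 < q := by linarith
  suffices H : ∃ c > 0, ∀ f g : Lp ℝ (ENNReal.ofReal q) μ, ‖f‖ ≤ 1 → ‖g‖ ≤ 1 →
      c * ‖f - g‖ ^ max 2 q ≤ 1 - (‖f + g‖ / 2) ^ q by
    obtain ⟨c, hc, H⟩ := H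
    refine ⟨2 * c / q, by positivity, fun f g hf hg => ?_⟩
    have h1 := one_add_mul_self_le_rpow_one_add
      (s := ‖f + g‖ / 2 - 1) (by linarith [norm_nonneg (f + g)]) hq1.le
    rw [add_sub_cancel] at h1
    have h2 := H f g hf hg
    have h3 : q * (2 * c / q * ‖f - g‖ ^ max 2 q) = 2 * (c * ‖f - g‖ ^ max 2 q) := by
      field_simp
    have h4 : q * ‖f + g‖ ≤ q * (2 - 2 * c / q * ‖f - g‖ ^ max 2 q) := by
      rw [mul_sub, h3]; linarith
    exact le_of_mul_le_mul_left h4 hq0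
  rcases le_total 2 q with hq2 | hq2
  · refine ⟨(2 ^ q)⁻¹, by positivity, fun f g hf hg => ?_⟩
    have h := Lp.norm_sub_rpow_le_of_forall hq0 (abs_sub_rpow_le_of_two_le hq2) f g
    have hf' := Real.rpow_le_one (norm_nonneg _) hf hq0.le
    have hg' := Real.rpow_le_one (norm_nonneg _) hg hq0.le
    have h2 : (2 : ℝ) ^ (q - 1) * (‖f‖ ^ q + ‖g‖ ^ q) ≤ 2 ^ (q - 1) * 2 :=
      mul_le_mul_of_nonneg_left (by linarith) (by positivity)
    have h3 : (2 : ℝ) ^ (q - 1) * 2 = 2 ^ q := by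
      rw [← Real.rpow_add_one (by norm_num)]; congr 1; ring
    rw [max_eq_right hq2, Real.div_rpow (norm_nonneg _) (by norm_num), inv_mul_eq_div,
      le_sub_iff_add_le, ← add_div, div_le_one (by positivity)]
    linarith
  · set K := 8 / (q * (q - 1)) with hK
    have hK0 : 0 < K := div_pos (by norm_num) (mul_pos hq0 (by linarith))
    set κ : ℝ := (1 / 4 : ℝ) ^ (q - 2) with hκ
    have hκ0 : 0 < κ := by positivity
    refine ⟨(2 * K * κ)⁻¹, by positivity, fun f g hf hg => ?_⟩
    have hf' := Real.rpow_le_one (norm_nonneg _) hf hq0.le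
    have hg' := Real.rpow_le_one (norm_nonneg _) hg hq0.le
    rw [max_eq_left hq2, Real.rpow_two, Real.div_rpow (norm_nonneg _) (by norm_num)]
    rcases (norm_nonneg (f - g)).eq_or_lt with h0 | h0
    · have h1 : ‖f + g‖ ≤ 2 := (norm_add_le _ _).trans (by linarith)
      have h2 : ‖f + g‖ ^ q / 2 ^ q ≤ 1 := by
        rw [div_le_one (by positivity)]
        exact Real.rpow_le_rpow (norm_nonneg _) h1 hq0.le
      rw [← h0]
      simpa using h2
    have h := Lp.norm_sub_rpow_le_of_forall hq0
      (abs_sub_rpow_le_of_le_two hq1 hq2 (θ := ‖f - g‖ * (1 / 4)) (by positivity)) f g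
    rw [← hK, Real.mul_rpow h0.le (by norm_num), Real.mul_rpow h0.le (by norm_num), ← hκ] at h
    have h14 : (1 / 4 : ℝ) ^ q ≤ 1 / 4 :=
      Real.rpow_le_self_of_le_one (by norm_num) (by norm_num) hq1.le
    have hq' : ‖f - g‖ ^ q = ‖f - g‖ ^ (q - 2) * ‖f - g‖ ^ 2 := by
      rw [← Real.rpow_two, ← Real.rpow_add h0]; congr 1; ring
    set E := ‖f - g‖ ^ (q - 2) with hE
    have hE0 : 0 < E := by positivity
    have hsum : ‖f‖ ^ q + ‖g‖ ^ q ≤ 2 := by linarith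
    set N := ‖f + g‖ ^ q / 2 ^ q with hN
    have hN' : K * (E * κ) / 2 ^ q * ‖f + g‖ ^ q = K * (E * κ) * N := by rw [hN]; ring
    rw [hN'] at h
    have h1 : (‖f - g‖ ^ q * (1 / 4) ^ q + K * (E * κ) / 2) * (‖f‖ ^ q + ‖g‖ ^ q) ≤
        (‖f - g‖ ^ q * (1 / 4) + K * (E * κ) / 2) * 2 := by
      gcongr
    have h2 : E * ‖f - g‖ ^ 2 ≤ E * (2 * K * κ * (1 - N)) := by
      rw [hq'] at h h1
      linarith
    rw [inv_mul_le_iff₀ (by positivity)]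
    exact le_of_mul_le_mul_left h2 hE0

end IntegrableFunctions

section Smoothness

theorem norm_add_add_norm_sub_le_of_uniformConvexity {E D : Type*} [NormedAddCommGroup E]
    [NormedSpace ℝ E] [NormedAddCommGroup D] [NormedSpace ℝ D] (e : D ≃ₗᵢ[ℝ] (E →L[ℝ] ℝ))
    {c s : ℝ} (hc : 0 < c) (hs : 1 < s)
    (hE : ∀ f g : E, ‖f‖ ≤ 1 → ‖g‖ ≤ 1 → ‖f + g‖ ≤ 2 - c * ‖f - g‖ ^ s)
    {d u : D} {ρ : ℝ} (hd : ‖d‖ ≤ 1) (hρ : 0 < ρ) (hu : ‖u‖ ≤ c * ρ ^ (s - 1)) :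
    ‖d + u‖ + ‖d - u‖ ≤ 2 + ‖u‖ * ρ := by
  refine le_of_forall_pos_le_add fun ε hε => ?_
  obtain ⟨f, hf1, hf⟩ := (e (d + u)).exists_norm_lt_one_lt_apply
    (show ‖e (d + u)‖ - ε / 2 < ‖e (d + u)‖ by linarith)
  obtain ⟨g, hg1, hg⟩ := (e (d - u)).exists_norm_lt_one_lt_apply
    (show ‖e (d - u)‖ - ε / 2 < ‖e (d - u)‖ by linarith)
  rw [e.norm_map] at hf hg
  have h1 : e (d + u) f + e (d - u) g = e d (f + g) + e u (f - g) := by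
    simp only [map_add, map_sub, _root_.add_apply, _root_.sub_apply]; ring
  have h2 : e d (f + g) ≤ ‖f + g‖ := by
    have := (le_abs_self _).trans ((e d).le_of_opNorm_le ((e.norm_map d).trans_le hd) (f + g))
    linarith
  have h3 : e u (f - g) ≤ ‖u‖ * ‖f - g‖ :=
    (le_abs_self _).trans ((e u).le_of_opNorm_le (e.norm_map u).le (f - g))
  have h4 := hE f g hf1.le hg1.le
  have h5 : ‖u‖ * ‖f - g‖ ≤ ‖u‖ * ρ + c * ‖f - g‖ ^ s := by
    rcases le_total ‖f - g‖ ρ with h | h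
    · have : 0 ≤ c * ‖f - g‖ ^ s := by positivity
      linarith [mul_le_mul_of_nonneg_left h (norm_nonneg u)]
    · have hδ : 0 < ‖f - g‖ := hρ.trans_le h
      have h6 : ‖f - g‖ ^ s = ‖f - g‖ ^ (s - 1) * ‖f - g‖ := by
        rw [← Real.rpow_add_one hδ.ne', sub_add_cancel]
      have h7 := Real.rpow_le_rpow hρ.le h (by linarith : 0 ≤ s - 1)
      have h8 : ‖u‖ ≤ c * ‖f - g‖ ^ (s - 1) := hu.trans (mul_le_mul_of_nonneg_left h7 hc.le)
      have h9 := mul_le_mul_of_nonneg_right h8 hδ.le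
      have h10 : 0 ≤ ‖u‖ * ρ := by positivity
      rw [h6]; linarith
  linarith

end Smoothness

section KadecKlee

theorem Ultrafilter.exists_tendsto_of_bounded {ι : Type*} (l : Ultrafilter ι) {a : ι → ℝ} {C : ℝ}
    (ha : ∀ n, a n ∈ Set.Icc 0 C) : ∃ L, Tendsto a l (𝓝 L) := by
  obtain ⟨L, -, hL⟩ := isCompact_Icc.ultrafilter_le_nhds (l.map a)
    (le_principal_iff.2 (mem_map.2 (univ_mem' ha)))
  exact ⟨L, hL⟩

theorem ContinuousLinearMap.exists_norm_le_one_norm_apply_eq {D F : Type*} [NormedAddCommGroup D]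
    [NormedSpace ℝ D] [FiniteDimensional ℝ D] [NormedAddCommGroup F] [NormedSpace ℝ F]
    (A : D →L[ℝ] F) : ∃ v, ‖v‖ ≤ 1 ∧ ‖A‖ ≤ ‖A v‖ := by
  have : ProperSpace D := FiniteDimensional.proper_real D
  obtain ⟨v, hv, hmax⟩ := (isCompact_closedBall (0 : D) 1).exists_isMaxOn
    ⟨0, Metric.mem_closedBall_self zero_le_one⟩ A.continuous.norm.continuousOn
  refine ⟨v, by simpa using hv, le_of_forall_lt fun r hr => ?_⟩
  obtain ⟨x, hx, hrx⟩ := A.exists_lt_apply_of_lt_opNorm hr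
  exact hrx.trans_le (hmax (by simpa using hx.le))

theorem ContinuousLinearMap.tendsto_norm_of_forall_tendsto {ι D F : Type*} [NormedAddCommGroup D]
    [NormedSpace ℝ D] [FiniteDimensional ℝ D] [NormedAddCommGroup F] [NormedSpace ℝ F]
    {l : Filter ι} {A : ι → D →L[ℝ] F} (h : ∀ d, Tendsto (fun n => ‖A n d‖) l (𝓝 0)) :
    Tendsto (fun n => ‖A n‖) l (𝓝 0) := by
  obtain ⟨C, -, hC⟩ := (Module.finBasis ℝ D).exists_opNorm_le (F := F)
  have hsum : Tendsto (fun n => C * ∑ i, ‖A n (Module.finBasis ℝ D i)‖) l (𝓝 0) := by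
    have := (tendsto_finsetSum Finset.univ
      fun i _ => h (Module.finBasis ℝ D i)).const_mul C
    simpa using this
  refine squeeze_zero (fun n => norm_nonneg _) (fun n => ?_) hsum
  exact hC (Finset.sum_nonneg fun i _ => norm_nonneg _) fun i =>
    Finset.single_le_sum (f := fun i => ‖A n (Module.finBasis ℝ D i)‖)
      (fun i _ => norm_nonneg _) (Finset.mem_univ i)

/-- Operators from a sufficiently smooth finite-dimensional space to the dual of `ℓ_P` satisfy the
Kadec-Klee property for pointwise convergence. -/
theorem lp.tendsto_norm_sub_of_pointwise {I ι D : Type*} {P : ℝ≥0∞} [Fact (1 ≤ P)] (hP : P ≠ ⊤)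
    [NormedAddCommGroup D] [NormedSpace ℝ D] [FiniteDimensional ℝ D]
    {c s : ℝ} (hc : 0 < c) (hs : 1 < s) (hsP : s < P.toReal)
    (hD : ∀ (d u : D) (ρ : ℝ), ‖d‖ ≤ 1 → 0 < ρ → ‖u‖ ≤ c * ρ ^ (s - 1) →
      ‖d + u‖ + ‖d - u‖ ≤ 2 + ‖u‖ * ρ)
    (l : Ultrafilter ι) {A : ι → D →L[ℝ] (lp (fun _ : I => ℝ) P →L[ℝ] ℝ)}
    {B : D →L[ℝ] (lp (fun _ : I => ℝ) P →L[ℝ] ℝ)}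
    (hA : ∀ n, ‖A n‖ ≤ 1) (hB : ‖B‖ = 1)
    (hAB : ∀ d x, Tendsto (fun n => A n d x) l (𝓝 (B d x))) :
    Tendsto (fun n => ‖A n - B‖) l (𝓝 0) := by
  have hP1 : 1 < P.toReal := hs.trans hsP
  have hAd : ∀ n d, ‖A n d‖ ≤ ‖d‖ := fun n d => by
    simpa using (A n).le_of_opNorm_le (hA n) d
  have hBd : ∀ d, ‖B d‖ ≤ ‖d‖ := fun d => by simpa using B.le_of_opNorm_le hB.le d
  have hex : ∀ d, ∃ L, Tendsto (fun n => ‖A n d - B d‖) l (𝓝 L) := fun d =>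
    l.exists_tendsto_of_bounded (C := ‖d‖ + ‖d‖) fun n =>
      ⟨norm_nonneg _, (norm_sub_le _ _).trans (add_le_add (hAd n d) (hBd d))⟩
  choose L hL using hex
  have hL0 : ∀ d, 0 ≤ L d := fun d => ge_of_tendsto' (hL d) fun n => norm_nonneg _
  obtain ⟨v, hv1, hv⟩ := B.exists_norm_le_one_norm_apply_eq
  rw [hB] at hv
  have hsup : ∀ (d : D) (b : ℝ), 0 ≤ b → b ≤ 1 → (1 - b ^ P.toReal) * ‖B d‖ + b * L d ≤ ‖d‖ :=
    fun d b hb0 hb1 => lp.norm_add_limit_norm_sub_le hP hP1 (hAB d) (fun n => hAd n d) (hL d)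
      hb0 hb1
  have hLtri : ∀ d u t, 2 * |t| * L u ≤ L (d + t • u) + L (d - t • u) := fun d u t => by
    refine le_of_tendsto_of_tendsto' ((hL u).const_mul (2 * |t|))
      ((hL (d + t • u)).add (hL (d - t • u))) fun n => ?_
    have h1 : (A n (d + t • u) - B (d + t • u)) - (A n (d - t • u) - B (d - t • u)) =
        (2 * t) • (A n u - B u) := by
      simp only [map_add, map_sub, map_smul]; module
    calc 2 * |t| * ‖A n u - B u‖ = ‖(2 * t) • (A n u - B u)‖ := by
          rw [norm_smul, Real.norm_eq_abs, abs_mul, abs_two]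
      _ ≤ _ := by rw [← h1]; exact norm_sub_le _ _
  have hLz : ∀ w, L w = 0 := by
    intro w
    rcases eq_or_ne w 0 with rfl | hw
    · refine tendsto_nhds_unique (hL 0) ?_
      simp
    have hw0 : 0 < ‖w‖ := norm_pos_iff.2 hw
    have hbound : ∀ η > 0, 2 * L w ≤ ‖w‖ * η := by
      intro η hη
      have hlim : Tendsto (fun b : ℝ => 2 * b ^ (P.toReal - s) * (‖w‖ / (c * η ^ (s - 1))) +
          ‖w‖ * η) (𝓝[>] 0) (𝓝 (‖w‖ * η)) := by
        have h : ContinuousAt (fun b : ℝ => 2 * b ^ (P.toReal - s) * (‖w‖ / (c * η ^ (s - 1))) +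
            ‖w‖ * η) 0 :=
          ((continuousAt_const.mul (Real.continuousAt_rpow_const _ _ (Or.inr (by linarith)))).mul
            continuousAt_const).add continuousAt_const
        have h2 := h.tendsto
        rw [Real.zero_rpow (by linarith), mul_zero, zero_mul, zero_add] at h2
        exact h2.mono_left nhdsWithin_le_nhds
      refine ge_of_tendsto hlim ?_
      filter_upwards [Ioc_mem_nhdsGT (zero_lt_one : (0 : ℝ) < 1)] with b hb
      have hb0 := hb.1
      have hbp1 : b ^ P.toReal ≤ 1 := Real.rpow_le_one hb0.le hb.2 (by linarith)
      set t := c * (η * b) ^ (s - 1) / ‖w‖ with ht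
      have ht0 : 0 < t := by positivity
      have htw : ‖t • w‖ = t * ‖w‖ := by rw [norm_smul, Real.norm_eq_abs, abs_of_pos ht0]
      have htw' : t * ‖w‖ = c * (η * b) ^ (s - 1) := by rw [ht]; field_simp
      have h1 := hD v (t • w) (η * b) hv1 (by positivity) (by rw [htw, htw'])
      have h2 := hsup (v + t • w) b hb0.le hb.2
      have h3 := hsup (v - t • w) b hb0.le hb.2
      have h4 := hLtri v w t
      rw [abs_of_pos ht0] at h4
      have h5 : 2 ≤ ‖B (v + t • w)‖ + ‖B (v - t • w)‖ := by
        have h6 : B (v + t • w) + B (v - t • w) = (2 : ℝ) • B v := by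
          simp only [map_add, map_sub]; module
        have h7 := norm_add_le (B (v + t • w)) (B (v - t • w))
        rw [h6, norm_smul, Real.norm_eq_abs, abs_two] at h7
        linarith
      have h6 : b * (2 * t * L w) ≤ 2 * b ^ P.toReal + t * ‖w‖ * (η * b) := by
        have h7 := mul_le_mul_of_nonneg_left h4 hb0.le
        have h8 := mul_le_mul_of_nonneg_left h5 (sub_nonneg.2 hbp1)
        rw [htw] at h1
        linarith
      have h7 : b ^ P.toReal = b ^ (P.toReal - s) * (b ^ (s - 1) * b) := by
        rw [← Real.rpow_add_one hb0.ne', ← Real.rpow_add hb0]; congr 1; ring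
      have h8 : b ^ (s - 1) = t * (‖w‖ / (c * η ^ (s - 1))) := by
        rw [ht, Real.mul_rpow hη.le hb0.le]; field_simp
      have h9 : (b * t) * (2 * L w) ≤ (b * t) *
          (2 * b ^ (P.toReal - s) * (‖w‖ / (c * η ^ (s - 1))) + ‖w‖ * η) := by
        rw [h7, h8] at h6
        linarith
      exact le_of_mul_le_mul_left h9 (by positivity)
    have hlim : Tendsto (fun η : ℝ => ‖w‖ * η) (𝓝[>] 0) (𝓝 0) := by
      have h : Tendsto (fun η : ℝ => ‖w‖ * η) (𝓝 0) (𝓝 (‖w‖ * 0)) :=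
        (continuous_const.mul continuous_id).tendsto 0
      rw [mul_zero] at h
      exact h.mono_left nhdsWithin_le_nhds
    have : 2 * L w ≤ 0 := ge_of_tendsto hlim (eventually_mem_nhdsWithin.mono hbound)
    linarith [hL0 w]
  refine ContinuousLinearMap.tendsto_norm_of_forall_tendsto fun d => ?_
  have := hL d
  rw [hLz d] at this
  exact this

end KadecKlee

section SubdifferentiabilityCriterion

/-- `z` is an SSD point if it strongly exposes the set of its norming functionals. -/
theorem isSSDPoint_of_norming {Z : Type*} [NormedAddCommGroup Z] [NormedSpace ℝ Z] {z : Z}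
    (hz : ‖z‖ = 1)
    (H : ∀ ε > 0, ∃ δ > 0, ∀ f : Z →L[ℝ] ℝ, ‖f‖ ≤ 1 → 1 - δ < f z →
      ∃ g : Z →L[ℝ] ℝ, ‖g‖ ≤ 1 ∧ g z = 1 ∧ ‖f - g‖ < ε) :
    IsSSDPoint z := by
  refine ⟨hz, fun h => sSup {r | ∃ g : Z →L[ℝ] ℝ, ‖g‖ ≤ 1 ∧ g z = 1 ∧ r = g h},
    fun ε hε => ?_⟩
  obtain ⟨δ, hδ, hH⟩ := H ε hε
  refine ⟨δ / 2, by positivity, fun t ht htδ h hh => ?_⟩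
  set S := {r | ∃ g : Z →L[ℝ] ℝ, ‖g‖ ≤ 1 ∧ g z = 1 ∧ r = g h} with hS
  have hle : ∀ (g : Z →L[ℝ] ℝ) (x : Z), ‖g‖ ≤ 1 → g x ≤ ‖x‖ := fun g x hg => by
    simpa using (le_abs_self _).trans (g.le_of_opNorm_le hg x)
  have hbdd : BddAbove S := ⟨1, by rintro r ⟨g, hg, -, rfl⟩; exact (hle g h hg).trans hh.le⟩
  obtain ⟨f, hf1, hf⟩ := exists_dual_vector'' ℝ (z + t • h)
  have hf' : f z + t * f h = ‖z + t • h‖ := by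
    rw [← smul_eq_mul, ← map_smul, ← map_add, hf]; rfl
  have hth : ‖t • h‖ = t := by rw [norm_smul, hh, mul_one, Real.norm_eq_abs, abs_of_pos ht]
  have hlow : 1 - t ≤ ‖z + t • h‖ := by
    have := norm_sub_le (z + t • h) (t • h)
    rw [add_sub_cancel_right, hz, hth] at this
    linarith
  have hfh : f h ≤ 1 := (hle f h hf1).trans hh.le
  obtain ⟨g, hg1, hgz, hfg⟩ := hH f hf1 (by nlinarith)
  have hgS : g h ≤ sSup S := le_csSup hbdd ⟨g, hg1, hgz, rfl⟩
  have hSle : sSup S ≤ (‖z + t • h‖ - 1) / t := by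
    refine csSup_le ⟨_, g, hg1, hgz, rfl⟩ ?_
    rintro r ⟨k, hk, hkz, rfl⟩
    rw [le_div_iff₀ ht]
    have := hle k (z + t • h) hk
    rw [map_add, map_smul, hkz, smul_eq_mul] at this
    linarith
  have hup : (‖z + t • h‖ - 1) / t ≤ f h := by
    rw [div_le_iff₀ ht, ← hf']
    have := hle f z hf1
    linarith
  have hfgh : f h - g h < ε := by
    have := (le_abs_self _).trans ((f - g).le_opNorm h)
    rw [hh, mul_one, _root_.sub_apply] at this
    linarith
  rw [abs_lt]
  constructor <;> linarith

end SubdifferentiabilityCriterion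

section ProjectiveTensorProduct

variable {X D Z : Type*} [NormedAddCommGroup X] [NormedSpace ℝ X] [NormedAddCommGroup D]
  [NormedSpace ℝ D] [NormedAddCommGroup Z] [NormedSpace ℝ Z]
  {tp : X →ₗ[ℝ] D →ₗ[ℝ] Z}

theorem projRepSums_bddBelow (z : Z) : BddBelow (projRepSums tp z) :=
  ⟨0, by rintro r ⟨k, u, v, -, rfl⟩; exact Finset.sum_nonneg fun i _ => by positivity⟩

variable [CompleteSpace Z]

theorem IsProjectiveTensorProduct.norm_apply_le (htp : IsProjectiveTensorProduct tp) (x : X)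
    (d : D) : ‖tp x d‖ ≤ ‖x‖ * ‖d‖ := by
  have h := htp.norm_eq 1 (fun _ => x) (fun _ => d)
  simp only [Finset.univ_unique, Finset.sum_singleton] at h
  rw [h]
  exact csInf_le (projRepSums_bddBelow _) ⟨1, fun _ => x, fun _ => d, by simp, by simp⟩

theorem IsProjectiveTensorProduct.opNorm_le (htp : IsProjectiveTensorProduct tp) (f : Z →L[ℝ] ℝ)
    {C : ℝ} (hC : 0 ≤ C) (hf : ∀ x d, ‖f (tp x d)‖ ≤ C * (‖x‖ * ‖d‖)) : ‖f‖ ≤ C := by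
  refine f.opNorm_le_bound hC fun z => ?_
  have hcl : IsClosed {z : Z | ‖f z‖ ≤ C * ‖z‖} :=
    isClosed_le f.continuous.norm (continuous_const.mul continuous_norm)
  refine closure_minimal (fun z hz => ?_) hcl (htp.dense_span z)
  obtain ⟨k, a, g, rfl⟩ := (Submodule.mem_span_set' (R := ℝ)).1 hz
  choose xy hxy using fun i => (g i).2
  have hsum : ∑ i, a i • (g i : Z) = ∑ i, tp (a i • (xy i).1) (xy i).2 :=
    Finset.sum_congr rfl fun i _ => by rw [map_smul, LinearMap.smul_apply, ← hxy i]
  rw [Set.mem_ofPred_eq, hsum]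
  set w := ∑ i, tp (a i • (xy i).1) (xy i).2 with hw
  have hrep : ∀ r ∈ projRepSums tp w, ‖f w‖ ≤ C * r := by
    rintro r ⟨m, u, v, huv, rfl⟩
    rw [huv, map_sum, Finset.mul_sum]
    exact (norm_sum_le _ _).trans (Finset.sum_le_sum fun i _ => hf _ _)
  have hne : (projRepSums tp w).Nonempty := ⟨_, k, _, _, hw, rfl⟩
  rw [hw, htp.norm_eq k, ← hw]
  rcases hC.eq_or_lt with h0 | h0
  · obtain ⟨r, hr⟩ := hne
    have := hrep r hr
    rw [← h0, zero_mul] at this ⊢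
    exact this
  · rw [← div_le_iff₀' h0]
    exact le_csInf hne fun r hr => (div_le_iff₀' h0).2 (hrep r hr)

/-- The operator `D → X*` associated with a functional on the projective tensor product. -/
noncomputable def IsProjectiveTensorProduct.toOperator (htp : IsProjectiveTensorProduct tp)
    (f : Z →L[ℝ] ℝ) : D →L[ℝ] (X →L[ℝ] ℝ) :=
  (ContinuousLinearMap.compL ℝ X Z ℝ f).comp
    (LinearMap.mkContinuous₂ tp.flip 1 fun d x => by
      rw [LinearMap.flip_apply, one_mul, mul_comm]; exact htp.norm_apply_le x d)

theorem IsProjectiveTensorProduct.toOperator_apply (htp : IsProjectiveTensorProduct tp)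
    (f : Z →L[ℝ] ℝ) (d : D) (x : X) : htp.toOperator f d x = f (tp x d) := rfl

theorem IsProjectiveTensorProduct.norm_toOperator (htp : IsProjectiveTensorProduct tp)
    (f : Z →L[ℝ] ℝ) : ‖htp.toOperator f‖ = ‖f‖ := by
  refine le_antisymm ?_ (htp.opNorm_le f (norm_nonneg (htp.toOperator f)) fun x d => ?_)
  · refine ContinuousLinearMap.opNorm_le_bound₂ _ (norm_nonneg _) fun d x => ?_
    rw [htp.toOperator_apply, mul_assoc, mul_comm ‖d‖]
    exact (f.le_opNorm _).trans (mul_le_mul_of_nonneg_left (htp.norm_apply_le x d) (norm_nonneg _))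
  · rw [← htp.toOperator_apply, mul_comm ‖x‖, ← mul_assoc]
    exact (htp.toOperator f).le_opNorm₂ d x

theorem IsProjectiveTensorProduct.toOperator_sub (htp : IsProjectiveTensorProduct tp)
    (f g : Z →L[ℝ] ℝ) : htp.toOperator f - htp.toOperator g = htp.toOperator (f - g) := by
  ext d x
  simp only [_root_.sub_apply, htp.toOperator_apply]

end ProjectiveTensorProduct

theorem Ultrafilter.exists_weakStar_limit {ι Z : Type*} [NormedAddCommGroup Z] [NormedSpace ℝ Z]
    (l : Ultrafilter ι) {f : ι → Z →L[ℝ] ℝ} {C : ℝ} (hf : ∀ n, ‖f n‖ ≤ C) :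
    ∃ g : Z →L[ℝ] ℝ, ‖g‖ ≤ C ∧ ∀ z, Tendsto (fun n => f n z) l (𝓝 (g z)) := by
  obtain ⟨g, hg, hlg⟩ := (WeakDual.isCompact_closedBall (𝕜 := ℝ) (0 : StrongDual ℝ Z)
    C).ultrafilter_le_nhds (l.map fun n => StrongDual.toWeakDual (f n))
    (le_principal_iff.2 (mem_map.2 (univ_mem' fun n => by simpa using hf n)))
  refine ⟨WeakDual.toStrongDual g, by simpa using hg, fun z => ?_⟩
  exact ((WeakDual.eval_continuous z).tendsto g).comp hlg

theorem IsProjectiveTensorProduct.isSSDPoint_lp {I D Z : Type*} {P : ℝ≥0∞} [Fact (1 ≤ P)]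
    (hP : P ≠ ⊤) [NormedAddCommGroup D] [NormedSpace ℝ D] [FiniteDimensional ℝ D]
    [NormedAddCommGroup Z] [NormedSpace ℝ Z] [CompleteSpace Z]
    {tp : lp (fun _ : I => ℝ) P →ₗ[ℝ] D →ₗ[ℝ] Z} (htp : IsProjectiveTensorProduct tp)
    {c s : ℝ} (hc : 0 < c) (hs : 1 < s) (hsP : s < P.toReal)
    (hD : ∀ (d u : D) (ρ : ℝ), ‖d‖ ≤ 1 → 0 < ρ → ‖u‖ ≤ c * ρ ^ (s - 1) →
      ‖d + u‖ + ‖d - u‖ ≤ 2 + ‖u‖ * ρ)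
    {z : Z} (hz : ‖z‖ = 1) : IsSSDPoint z := by
  refine isSSDPoint_of_norming hz fun ε hε => ?_
  by_contra! hcon
  choose f hf1 hfz hfar using fun n : ℕ => hcon (1 / ((n : ℝ) + 1)) (by positivity)
  let l := hyperfilter ℕ
  obtain ⟨g, hg1, hg⟩ := l.exists_weakStar_limit hf1
  have hle : ∀ k : Z →L[ℝ] ℝ, k z ≤ ‖k‖ := fun k => by
    simpa [hz] using (le_abs_self _).trans (k.le_opNorm z)
  have hlim : Tendsto (fun n => f n z) l (𝓝 1) := by
    have h1 : Tendsto (fun n : ℕ => 1 - 1 / ((n : ℝ) + 1)) l (𝓝 1) := by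
      have h := (tendsto_one_div_add_atTop_nhds_zero_nat (𝕜 := ℝ)).const_sub 1
      rw [sub_zero] at h
      exact h.mono_left Nat.hyperfilter_le_atTop
    exact tendsto_of_tendsto_of_tendsto_of_le_of_le h1 tendsto_const_nhds
      (fun n => (hfz n).le) fun n => (hle _).trans (hf1 n)
  have hgz : g z = 1 := tendsto_nhds_unique (hg z) hlim
  have hgn : ‖g‖ = 1 := le_antisymm hg1 (hgz ▸ hle g)
  have hnorm := lp.tendsto_norm_sub_of_pointwise hP hc hs hsP hD l
    (A := fun n => htp.toOperator (f n)) (B := htp.toOperator g)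
    (fun n => (htp.norm_toOperator _).trans_le (hf1 n)) ((htp.norm_toOperator _).trans hgn)
    fun d x => hg (tp x d)
  simp only [htp.toOperator_sub, htp.norm_toOperator] at hnorm
  obtain ⟨n, hn⟩ := (hnorm.eventually_lt_const hε).exists
  exact (hfar n g hg1 hgz).not_gt hn

/-- **Corollary 3.4.** Let `I` be an infinite set and `p, q` real numbers with `1 < q < ∞` and
`p > max{2, q}`. If `Y` is a finite-dimensional subspace of some `L_q(μ)`, then the norm of
`ℓ_p(I) ⊗̂_π Y*` is SSD at every point of its unit sphere. Here `D` is (an isometric copy of)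
the dual space `Y*`, and `Z` together with `tp` is the projective tensor product
`ℓ_p(I) ⊗̂_π D`. -/
theorem ssd_of_projectiveTensorProduct_lp_dual_subspace_Lq
    (p q : ℝ) (hq : 1 < q) (hp : max 2 q < p)
    (I : Type*) [Infinite I] [Fact (1 ≤ ENNReal.ofReal p)]
    (Ω : Type*) [MeasurableSpace Ω] (μ : MeasureTheory.Measure Ω)
    [Fact (1 ≤ ENNReal.ofReal q)]
    (Y : Submodule ℝ (MeasureTheory.Lp ℝ (ENNReal.ofReal q) μ)) [FiniteDimensional ℝ Y]
    (D : Type*) [NormedAddCommGroup D] [NormedSpace ℝ D]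
    (e : D ≃ₗᵢ[ℝ] (Y →L[ℝ] ℝ))
    (Z : Type*) [NormedAddCommGroup Z] [NormedSpace ℝ Z] [CompleteSpace Z]
    (tp : lp (fun _ : I => ℝ) (ENNReal.ofReal p) →ₗ[ℝ] D →ₗ[ℝ] Z)
    (htp : IsProjectiveTensorProduct tp) :
    ∀ z : Z, ‖z‖ = 1 → IsSSDPoint z := by
  have hq0 : 0 < q := by linarith
  have hp0 : 0 < p := by linarith [le_max_left 2 q]
  obtain ⟨c, hc, hLq⟩ := Lp.exists_norm_add_le_two_sub μ hq
  have : FiniteDimensional ℝ D := e.symm.toLinearEquiv.finiteDimensional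
  have hs : 1 < max 2 q := lt_max_of_lt_left one_lt_two
  exact fun z hz => htp.isSSDPoint_lp ENNReal.ofReal_ne_top hc hs
    (by rwa [ENNReal.toReal_ofReal hp0.le])
    (fun d u ρ hd hρ hu => norm_add_add_norm_sub_le_of_uniformConvexity e hc hs
      (fun f g hf hg => hLq f g hf hg) hd hρ hu) hz
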